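/- Let α ≠ 0, β ≠ 0, σ > 0 and y be real numbers, and for λ ∈ ℤ define ρ(λ) = ∑_{k ∈ ℤ} exp(−(y − βλ + kα)²/(2σ²)). For λ, λ' ∈ ℤ, if the distance from y − βλ to the lattice αℤ is at most the distance from y − βλ' to αℤ (equivalently, inf_{k∈ℤ} |y − βλ + kα| ≤ inf_{k∈ℤ} |y − βλ' + kα|), then ρ(λ) ≥ ρ(λ'). Consequently, any pair (λ̂, k̂) ∈ ℤ² minimizing |y − βλ + kα| over all (λ, k) ∈ ℤ² with λ ranging over a given finite set Λ₀ ⊆ ℤ yields a maximizer λ̂ of ρ over Λ₀. -/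

import Mathlib

open Filter Topology

/-- The reciprocal `1 / ((1 - Q) (1 - Q ^ 2) ⋯ (1 - Q ^ m))` of the `Q`-Pochhammer symbol,
extended by zero to negative `m`. -/
noncomputable def invQPochhammer (Q : ℝ) (m : ℤ) : ℝ :=
  if m < 0 then 0 else ∏ i ∈ Finset.range m.toNat, (1 - Q ^ (i + 1))⁻¹

lemma one_sub_pow_succ_pos {Q : ℝ} (h0 : 0 < Q) (h1 : Q < 1) (i : ℕ) : 0 < 1 - Q ^ (i + 1) :=
  sub_pos.2 (pow_lt_one₀ h0.le h1 i.succ_ne_zero)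

lemma one_sub_zpow_mul_invQPochhammer {Q : ℝ} (h0 : 0 < Q) (h1 : Q < 1) (m : ℤ) :
    (1 - Q ^ m) * invQPochhammer Q m = invQPochhammer Q (m - 1) := by
  rcases lt_trichotomy m 0 with hm | rfl | hm
  · simp [invQPochhammer, hm, show m - 1 < 0 by lia]
  · simp [invQPochhammer]
  · obtain ⟨n, rfl⟩ : ∃ n : ℕ, m = n + 1 := ⟨(m - 1).toNat, by lia⟩
    have hn : ((n : ℤ) + 1).toNat = n + 1 := by lia
    have hpos := (one_sub_pow_succ_pos h0 h1 n).ne'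
    have hz : Q ^ ((n : ℤ) + 1) = Q ^ (n + 1) := by exact_mod_cast zpow_natCast Q (n + 1)
    simp only [invQPochhammer, hn, hz, Finset.prod_range_succ, add_sub_cancel_right,
      Int.toNat_natCast, not_lt.2 hm.le, if_false, not_lt.2 (Int.natCast_nonneg n)]
    field_simp

lemma exists_tendsto_invQPochhammer {Q : ℝ} (h0 : 0 < Q) (h1 : Q < 1) :
    ∃ L : ℝ, 0 < L ∧ Tendsto (invQPochhammer Q) atTop (𝓝 L) := by
  have hs : Summable fun i : ℕ => ‖-Q ^ (i + 1)‖ := by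
    simpa [abs_of_pos h0] using
      (summable_nat_add_iff 1).2 (summable_geometric_of_lt_one h0.le h1)
  have hne : ∏' i : ℕ, (1 + -Q ^ (i + 1)) ≠ 0 :=
    tprod_one_add_ne_zero_of_summable
      (fun i => by simpa [← sub_eq_add_neg] using (one_sub_pow_succ_pos h0 h1 i).ne') hs
  have ht := (((multipliable_one_add_of_summable hs).hasProd.inv₀ hne).tendsto_prod_nat)
  have ht' : Tendsto (fun n : ℕ => invQPochhammer Q n) atTop
      (𝓝 (∏' i : ℕ, (1 + -Q ^ (i + 1)))⁻¹) := by
    refine ht.congr fun n => ?_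
    simp [invQPochhammer, sub_eq_add_neg]
  refine ⟨_, lt_of_le_of_ne (ge_of_tendsto' ht' fun n => ?_) (inv_ne_zero hne).symm, ?_⟩
  · rw [invQPochhammer, if_neg (by lia)]
    exact Finset.prod_nonneg fun i _ => (inv_pos.2 (one_sub_pow_succ_pos h0 h1 i)).le
  · have := ht'.comp (tendsto_atTop_atTop.2 fun b => ⟨(b : ℤ), fun a ha => by lia⟩ :
      Tendsto Int.toNat atTop atTop)
    refine this.congr' ?_
    filter_upwards [eventually_ge_atTop 0] with m hm
    simp [Int.toNat_of_nonneg hm]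

lemma exists_abs_invQPochhammer_le {Q : ℝ} (h0 : 0 < Q) (h1 : Q < 1) :
    ∃ M : ℝ, ∀ m, |invQPochhammer Q m| ≤ M := by
  obtain ⟨L, -, hL⟩ := exists_tendsto_invQPochhammer h0 h1
  obtain ⟨M, hM⟩ := (hL.abs.comp tendsto_natCast_atTop_atTop).bddAbove_range
  have hM' : ∀ n : ℕ, |invQPochhammer Q n| ≤ M := fun n => hM ⟨n, rfl⟩
  refine ⟨M, fun m => ?_⟩
  rcases lt_or_ge m 0 with hm | hm
  · simpa [invQPochhammer, hm] using (abs_nonneg _).trans (hM' 0)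
  · simpa [Int.toNat_of_nonneg hm] using hM' m.toNat

/-- The coefficient of `z ^ j` in the finite Jacobi triple product, divided by `(q²; q²)_{2n}`. -/
noncomputable def tripleProductCoeff (q : ℝ) (n : ℕ) (j : ℤ) : ℝ :=
  q ^ (j ^ 2) * invQPochhammer (q ^ 2) (n + j) * invQPochhammer (q ^ 2) (n - j)

lemma tripleProductCoeff_succ {q : ℝ} (h0 : 0 < q) (h1 : q < 1) (n : ℕ) (j : ℤ) :
    (1 - q ^ (4 * n + 2)) * (1 - q ^ (4 * n + 4)) * tripleProductCoeff q (n + 1) j =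
      (1 + q ^ (4 * n + 2)) * tripleProductCoeff q n j + q ^ (2 * n + 1) *
        (tripleProductCoeff q n (j - 1) + tripleProductCoeff q n (j + 1)) := by
  have hq := h0.ne'
  have hQ0 : 0 < q ^ 2 := by positivity
  have hQ1 : q ^ 2 < 1 := pow_lt_one₀ h0.le h1 two_ne_zero
  have hrec := one_sub_zpow_mul_invQPochhammer hQ0 hQ1
  have e1 := hrec (n + 1 + j)
  have e2 := hrec (n + j)
  have e3 := hrec (n + 1 - j)
  have e4 := hrec (n - j)
  rw [show (n : ℤ) + 1 + j - 1 = n + j by ring] at e1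
  rw [show (n : ℤ) + 1 - j - 1 = n - j by ring] at e3
  have hA : (q ^ 2) ^ ((n : ℤ) + 1 + j) = (q ^ 2) ^ ((n : ℤ) + j) * q ^ 2 := by
    rw [← zpow_add_one₀ (by positivity)]; congr 1; ring
  have hC : (q ^ 2) ^ ((n : ℤ) + 1 - j) = (q ^ 2) ^ ((n : ℤ) - j) * q ^ 2 := by
    rw [← zpow_add_one₀ (by positivity)]; congr 1; ring
  have hAC : q ^ (4 * n) = (q ^ 2) ^ ((n : ℤ) + j) * (q ^ 2) ^ ((n : ℤ) - j) := by
    rw [← zpow_add₀ (by positivity), ← zpow_natCast, ← zpow_natCast, ← zpow_mul]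
    congr 1; push_cast; ring
  have hp : q ^ (2 * n + 1) * q ^ ((j + 1) ^ 2) =
      q ^ (j ^ 2) * ((q ^ 2) ^ ((n : ℤ) + j) * q ^ 2) := by
    rw [← hA, ← zpow_natCast q (2 * n + 1), ← zpow_natCast q 2, ← zpow_mul, ← zpow_add₀ hq,
      ← zpow_add₀ hq]
    congr 1; push_cast; ring
  have hm : q ^ (2 * n + 1) * q ^ ((j - 1) ^ 2) =
      q ^ (j ^ 2) * ((q ^ 2) ^ ((n : ℤ) - j) * q ^ 2) := by
    rw [← hC, ← zpow_natCast q (2 * n + 1), ← zpow_natCast q 2, ← zpow_mul, ← zpow_add₀ hq,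
      ← zpow_add₀ hq]
    congr 1; push_cast; ring
  simp only [tripleProductCoeff]
  push_cast
  rw [show (n : ℤ) + (j - 1) = n + j - 1 by ring, show (n : ℤ) - (j - 1) = n + 1 - j by ring,
    show (n : ℤ) + (j + 1) = n + 1 + j by ring, show (n : ℤ) - (j + 1) = n - j - 1 by ring,
    mul_add]
  simp only [← mul_assoc]
  rw [hm, hp, ← e2, ← e4, ← e1, ← e3, pow_add, pow_add, hAC, hA, hC]
  ring

/-- The finite product of the Jacobi triple product at `z = exp (i θ)`, `c = cos θ`. -/
noncomputable def tripleProduct (q : ℝ) (n : ℕ) (c : ℝ) : ℝ :=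
  ∏ k ∈ Finset.range n, (1 + q ^ (4 * k + 2) + 2 * q ^ (2 * k + 1) * c) /
    ((1 - q ^ (4 * k + 2)) * (1 - q ^ (4 * k + 4)))

lemma hasSum_tripleProductCoeff {q : ℝ} (h0 : 0 < q) (h1 : q < 1) (n : ℕ) {z : ℂ} {c : ℝ}
    (hz : z ≠ 0) (hc : z + z⁻¹ = 2 * c) :
    HasSum (fun j : ℤ => (tripleProductCoeff q n j : ℂ) * z ^ j) (tripleProduct q n c) := by
  induction n with
  | zero =>
    convert hasSum_single (0 : ℤ) (fun j hj => ?_) using 1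
    · simp [tripleProduct, tripleProductCoeff, invQPochhammer]
    · rcases lt_or_gt_of_ne hj with h | h <;> simp [tripleProductCoeff, invQPochhammer, h]
  | succ n ih =>
    have hm := ((Equiv.addRight (-1 : ℤ)).hasSum_iff.2 ih).mul_right z
    have hp := ((Equiv.addRight (1 : ℤ)).hasSum_iff.2 ih).mul_right z⁻¹
    have h2 : (1 - q ^ (4 * n + 2)) ≠ 0 := (one_sub_pow_succ_pos h0 h1 (4 * n + 1)).ne'
    have h4 : (1 - q ^ (4 * n + 4)) ≠ 0 := (one_sub_pow_succ_pos h0 h1 (4 * n + 3)).ne'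
    have key := ((ih.mul_left ((1 + q ^ (4 * n + 2) : ℝ) : ℂ)).add
      ((hm.add hp).mul_left ((q ^ (2 * n + 1) : ℝ) : ℂ))).mul_left
        ((((1 - q ^ (4 * n + 2)) * (1 - q ^ (4 * n + 4)))⁻¹ : ℝ) : ℂ)
    convert! key using 1
    · funext j
      have hcoeff : tripleProductCoeff q (n + 1) j =
          ((1 - q ^ (4 * n + 2)) * (1 - q ^ (4 * n + 4)))⁻¹ *
            ((1 + q ^ (4 * n + 2)) * tripleProductCoeff q n j + q ^ (2 * n + 1) *
              (tripleProductCoeff q n (j - 1) + tripleProductCoeff q n (j + 1))) := by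
        rw [← tripleProductCoeff_succ h0 h1, inv_mul_cancel_left₀ (mul_ne_zero h2 h4)]
      have hz1 : z ^ (j - 1) * z = z ^ j := by rw [← zpow_add_one₀ hz]; congr 1; ring
      have hz2 : z ^ (j + 1) * z⁻¹ = z ^ j := by rw [← zpow_sub_one₀ hz]; congr 1; ring
      simp only [Function.comp_apply, Equiv.coe_addRight, mul_assoc, hz1, hz2, hcoeff,
        ← sub_eq_add_neg]
      push_cast
      ring
    · have : (tripleProduct q n c : ℂ) * z + tripleProduct q n c * z⁻¹ =
          tripleProduct q n c * (2 * c) := by rw [← hc]; ring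
      rw [this, tripleProduct, Finset.prod_range_succ, ← tripleProduct]
      push_cast
      ring

lemma tripleProduct_mono {q : ℝ} (h0 : 0 < q) (h1 : q < 1) (n : ℕ) {c d : ℝ}
    (hc : -1 ≤ c) (hcd : c ≤ d) : tripleProduct q n c ≤ tripleProduct q n d := by
  have hden (k : ℕ) : 0 < (1 - q ^ (4 * k + 2)) * (1 - q ^ (4 * k + 4)) :=
    mul_pos (one_sub_pow_succ_pos h0 h1 (4 * k + 1)) (one_sub_pow_succ_pos h0 h1 (4 * k + 3))
  refine Finset.prod_le_prod (fun k _ => div_nonneg ?_ (hden k).le) fun k _ => ?_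
  · have hk : 0 < q ^ (2 * k + 1) := by positivity
    have hsq : q ^ (4 * k + 2) = (q ^ (2 * k + 1)) ^ 2 := by rw [← pow_mul]; congr 1; ring
    rw [hsq]
    nlinarith [sq_nonneg (1 - q ^ (2 * k + 1))]
  · have := hden k
    gcongr

lemma summable_zpow_sq {q : ℝ} (h0 : 0 < q) (h1 : q < 1) : Summable fun j : ℤ => q ^ (j ^ 2) := by
  have hs : Summable fun n : ℕ => q ^ ((n : ℤ) ^ 2) := by
    refine (summable_geometric_of_lt_one h0.le h1).of_nonneg_of_le (fun n => by positivity)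
      fun n => ?_
    rw [← zpow_natCast q n]
    exact zpow_le_zpow_right_of_le_one₀ h0 h1.le (by nlinarith [sq_nonneg ((n : ℤ) - 1)])
  exact Summable.of_nat_of_neg hs (by simpa using hs)

/-- The limit `n → ∞` of the finite Jacobi triple product. -/
lemma exists_tendsto_tripleProduct {q : ℝ} (h0 : 0 < q) (h1 : q < 1) :
    ∃ L : ℝ, 0 < L ∧ ∀ (z : ℂ) (c : ℝ), ‖z‖ = 1 → z + z⁻¹ = 2 * c →
      Tendsto (fun n => (tripleProduct q n c : ℂ)) atTop
        (𝓝 (L * ∑' j : ℤ, ((q ^ (j ^ 2) : ℝ) : ℂ) * z ^ j)) := by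
  have hQ0 : 0 < q ^ 2 := by positivity
  have hQ1 : q ^ 2 < 1 := pow_lt_one₀ h0.le h1 two_ne_zero
  obtain ⟨L, hL0, hL⟩ := exists_tendsto_invQPochhammer hQ0 hQ1
  obtain ⟨M, hM⟩ := exists_abs_invQPochhammer_le hQ0 hQ1
  refine ⟨L * L, mul_pos hL0 hL0, fun z c hz hc => ?_⟩
  have hz0 : z ≠ 0 := norm_ne_zero_iff.1 (by simp [hz])
  have hn : Tendsto (fun n : ℕ => (n : ℤ)) atTop atTop := tendsto_natCast_atTop_atTop
  rw [← tsum_mul_left]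
  refine Tendsto.congr (fun n => (hasSum_tripleProductCoeff h0 h1 n hz0 hc).tsum_eq) ?_
  refine tendsto_tsum_of_dominated_convergence
    (((summable_zpow_sq h0 h1).mul_right M).mul_right M) (fun j => ?_)
    (Eventually.of_forall fun n j => ?_)
  · have ha := hL.comp (tendsto_atTop_add_const_right _ j hn)
    have hb := hL.comp (tendsto_atTop_add_const_right _ (-j) hn)
    have := ((ha.const_mul (q ^ (j ^ 2))).mul hb)
    have := (Complex.continuous_ofReal.tendsto _).comp this
    convert! this.mul_const (z ^ j) using 2
    push_cast
    ring
  · have hM0 := (abs_nonneg _).trans (hM 0)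
    have hq : 0 < q ^ (j ^ 2) := by positivity
    rw [norm_mul, norm_zpow, hz, one_zpow, mul_one, Complex.norm_real, Real.norm_eq_abs,
      tripleProductCoeff, abs_mul, abs_mul, abs_of_pos hq]
    gcongr <;> apply hM

/-- The Poisson summation formula for the periodized Gaussian. -/
lemma tsum_exp_neg_mul_add_int_sq {c : ℝ} (hc : 0 < c) (x : ℝ) :
    ((∑' k : ℤ, Real.exp (-c * (x + k) ^ 2) : ℝ) : ℂ) = (Real.sqrt (Real.pi / c) : ℂ) *
      ∑' j : ℤ, ((Real.exp (-(Real.pi ^ 2 / c)) ^ (j ^ 2) : ℝ) : ℂ) *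
        Complex.exp ((-(2 * Real.pi * x) : ℝ) * Complex.I) ^ j := by
  have ha : 0 < Real.pi / c := div_pos Real.pi_pos hc
  have hc' : (c : ℂ) ≠ 0 := by exact_mod_cast hc.ne'
  have hpi : (Real.pi : ℂ) ≠ 0 := by exact_mod_cast Real.pi_ne_zero
  have h := Complex.tsum_exp_neg_quadratic (a := ((Real.pi / c : ℝ) : ℂ))
    (by simpa using ha) (-Complex.I * x)
  have hsqrt : ((Real.pi / c : ℝ) : ℂ) ^ (1 / 2 : ℂ) = (Real.sqrt (Real.pi / c) : ℂ) := by
    rw [Real.sqrt_eq_rpow, Complex.ofReal_cpow ha.le]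
    norm_num
  have hs0 : (Real.sqrt (Real.pi / c) : ℂ) ≠ 0 := by
    exact_mod_cast (Real.sqrt_pos.2 ha).ne'
  have hl (j : ℤ) : ((Real.exp (-(Real.pi ^ 2 / c)) ^ (j ^ 2) : ℝ) : ℂ) *
        Complex.exp ((-(2 * Real.pi * x) : ℝ) * Complex.I) ^ j =
      Complex.exp (-Real.pi * ((Real.pi / c : ℝ) : ℂ) * j ^ 2 +
        2 * Real.pi * (-Complex.I * x) * j) := by
    rw [Complex.ofReal_zpow, Complex.ofReal_exp, ← Complex.exp_int_mul, ← Complex.exp_int_mul,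
      ← Complex.exp_add]
    congr 1
    push_cast
    ring
  have hr (k : ℤ) : ((Real.exp (-c * (x + k) ^ 2) : ℝ) : ℂ) =
      Complex.exp (-Real.pi / ((Real.pi / c : ℝ) : ℂ) *
        (k + Complex.I * (-Complex.I * x)) ^ 2) := by
    rw [Complex.ofReal_exp]
    congr 1
    have hI : Complex.I * (-Complex.I * x) = x := by
      rw [← mul_assoc, mul_neg, Complex.I_mul_I, neg_neg, one_mul]
    rw [hI]
    push_cast
    field_simp
    ring
  rw [Complex.ofReal_tsum, tsum_congr hr, tsum_congr hl, h, hsqrt, ← mul_assoc (Real.sqrt _ : ℂ),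
    mul_one_div_cancel hs0, one_mul]

/-- The periodized Gaussian is a monotone function of `cos (2 π x)`. -/
lemma tsum_exp_neg_mul_add_int_sq_le {c : ℝ} (hc : 0 < c) {x y : ℝ}
    (hxy : Real.cos (2 * Real.pi * x) ≤ Real.cos (2 * Real.pi * y)) :
    ∑' k : ℤ, Real.exp (-c * (x + k) ^ 2) ≤ ∑' k : ℤ, Real.exp (-c * (y + k) ^ 2) := by
  set q := Real.exp (-(Real.pi ^ 2 / c)) with hq
  have h0 : 0 < q := Real.exp_pos _
  have h1 : q < 1 := Real.exp_lt_one_iff.2 (neg_neg_of_pos (by positivity))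
  have ha : 0 < Real.sqrt (Real.pi / c) := Real.sqrt_pos.2 (div_pos Real.pi_pos hc)
  obtain ⟨L, hL0, hL⟩ := exists_tendsto_tripleProduct h0 h1
  have hlim (t : ℝ) : Tendsto (fun n => tripleProduct q n (Real.cos (2 * Real.pi * t))) atTop
      (𝓝 (L / Real.sqrt (Real.pi / c) * ∑' k : ℤ, Real.exp (-c * (t + k) ^ 2))) := by
    have h := hL (Complex.exp ((-(2 * Real.pi * t) : ℝ) * Complex.I))
      (Real.cos (2 * Real.pi * t)) (Complex.norm_exp_ofReal_mul_I _) (by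
        rw [← Complex.exp_neg, Complex.ofReal_cos, Complex.two_cos]
        push_cast
        rw [add_comm]
        congr 2
        ring)
    rw [← tendsto_ofReal_iff]
    convert h using 2
    have hs0 : (Real.sqrt (Real.pi / c) : ℂ) ≠ 0 := by exact_mod_cast ha.ne'
    rw [Complex.ofReal_mul, tsum_exp_neg_mul_add_int_sq hc, ← hq, Complex.ofReal_div]
    field_simp
  exact le_of_mul_le_mul_left (le_of_tendsto_of_tendsto' (hlim x) (hlim y) fun n =>
    tripleProduct_mono h0 h1 n (Real.neg_one_le_cos _) hxy) (div_pos hL0 ha)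

lemma cos_two_pi_mul_eq_cos_abs_sub_round (x : ℝ) :
    Real.cos (2 * Real.pi * x) = Real.cos (2 * Real.pi * |x - round x|) := by
  rw [show 2 * Real.pi * |x - round x| = |2 * Real.pi * (x - round x)| by
    rw [abs_mul, abs_of_pos Real.two_pi_pos], Real.cos_abs,
    show 2 * Real.pi * (x - round x) = 2 * Real.pi * x - round x * (2 * Real.pi) by ring,
    Real.cos_sub_int_mul_two_pi]

lemma cos_two_pi_mul_le_of_abs_sub_round_le {x y : ℝ} (h : |y - round y| ≤ |x - round x|) :
    Real.cos (2 * Real.pi * x) ≤ Real.cos (2 * Real.pi * y) := by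
  rw [cos_two_pi_mul_eq_cos_abs_sub_round x, cos_two_pi_mul_eq_cos_abs_sub_round y]
  have := abs_sub_round x
  refine Real.cos_le_cos_of_nonneg_of_le_pi (by positivity) ?_ (by gcongr)
  nlinarith [Real.pi_pos]

lemma bddBelow_range_abs_add_int_mul (w α : ℝ) :
    BddBelow (Set.range fun k : ℤ => |w + k * α|) :=
  ⟨0, by rintro _ ⟨k, rfl⟩; exact abs_nonneg _⟩

lemma iInf_abs_add_int_mul {α : ℝ} (hα : α ≠ 0) (w : ℝ) :
    ⨅ k : ℤ, |w + k * α| = |α| * |w / α - round (w / α)| := by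
  have h (k : ℤ) : |w + k * α| = |α| * |w / α - (-k : ℤ)| := by
    rw [← abs_mul]
    congr 1
    push_cast
    field_simp
    ring
  refine le_antisymm ((ciInf_le (bddBelow_range_abs_add_int_mul w α)
    (-round (w / α))).trans_eq ?_) (le_ciInf fun k => ?_)
  · rw [h, neg_neg]
  · rw [h]
    exact mul_le_mul_of_nonneg_left (round_le (w / α) (-k)) (abs_nonneg α)


/-- with `ρ(λ) = ∑_{k∈ℤ} exp(−(y − βλ + kα)²/(2σ²))` for `λ ∈ ℤ`
(`α ≠ 0`, `β ≠ 0`, `σ > 0`): if the distance from `y − βλ` to the lattice `αℤ` is at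
most the distance from `y − βλ'` to `αℤ`, then `ρ(λ) ≥ ρ(λ')`; consequently, any pair
`(λ̂, k̂)` minimizing `|y − βλ + kα|` over `(λ, k) ∈ Λ₀ × ℤ` (for a finite set
`Λ₀ ⊆ ℤ`) yields a maximizer `λ̂` of `ρ` over `Λ₀`. -/
theorem ml_decoding_reduces_to_diophantine_approximation (α β σ y : ℝ)
    (hα : α ≠ 0) (hβ : β ≠ 0) (hσ : 0 < σ) :
    let ρ : ℤ → ℝ :=
      fun lam => ∑' k : ℤ, Real.exp (-(y - β * lam + k * α) ^ 2 / (2 * σ ^ 2))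
    (∀ lam lam' : ℤ,
      (⨅ k : ℤ, |y - β * lam + k * α|) ≤ (⨅ k : ℤ, |y - β * lam' + k * α|) →
        ρ lam' ≤ ρ lam) ∧
    (∀ Λ₀ : Finset ℤ, ∀ lamhat khat : ℤ, lamhat ∈ Λ₀ →
      (∀ lam ∈ Λ₀, ∀ k : ℤ, |y - β * lamhat + khat * α| ≤ |y - β * lam + k * α|) →
      ∀ lam ∈ Λ₀, ρ lam ≤ ρ lamhat) := by
  intro ρ
  have hρ (lam : ℤ) : ρ lam =
      ∑' k : ℤ, Real.exp (-(α ^ 2 / (2 * σ ^ 2)) * ((y - β * lam) / α + k) ^ 2) := by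
    refine tsum_congr fun k => ?_
    congr 1
    field_simp
  have hmono (lam lam' : ℤ)
      (h : (⨅ k : ℤ, |y - β * lam + k * α|) ≤ ⨅ k : ℤ, |y - β * lam' + k * α|) :
      ρ lam' ≤ ρ lam := by
    rw [iInf_abs_add_int_mul hα, iInf_abs_add_int_mul hα] at h
    rw [hρ, hρ]
    exact tsum_exp_neg_mul_add_int_sq_le (by positivity)
      (cos_two_pi_mul_le_of_abs_sub_round_le (le_of_mul_le_mul_left h (abs_pos.2 hα)))
  exact ⟨hmono, fun Λ₀ lamhat khat _ hmin lam hlam => hmono _ _ <|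
    (ciInf_le (bddBelow_range_abs_add_int_mul _ α) khat).trans
      (le_ciInf fun k => hmin lam hlam k)⟩
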